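/- arXiv:1702.07749 — 10 statements merged into one kernel-verified Lean document; each statement's English description precedes it below -/
import Mathlib

section
/- (Theorem 1, per nodal point.) Let A be a symmetric n×n real matrix, let w ∈ ℝⁿ with w ≠ 0, and let m ∈ ℝⁿ. Then A = m wᵀ + w mᵀ holds if and only if all three of the following hold: (i) ⟨w, m⟩ = ⟨w, A w⟩ / (2⟨w, w⟩); (ii) ⟨v, m⟩ = ⟨v, A w⟩ / ⟨w, w⟩ for every v ∈ ℝⁿ with ⟨v, w⟩ = 0; (iii) ⟨v, A u⟩ = 0 for all u, v ∈ ℝⁿ with ⟨u, w⟩ = 0 and ⟨v, w⟩ = 0. -/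
open Matrix

theorem dotProduct_mulVec_outer_add_outer {n : ℕ} (m w x y : Fin n → ℝ) :
    x ⬝ᵥ (vecMulVec m w + vecMulVec w m).mulVec y
      = (x ⬝ᵥ m) * (w ⬝ᵥ y) + (x ⬝ᵥ w) * (m ⬝ᵥ y) := by
  simp [add_mulVec, vecMulVec_mulVec, dotProduct_add, mul_comm]

theorem dotProduct_mulVec_comm_of_isSymm {n : ℕ} {A : Matrix (Fin n) (Fin n) ℝ}
    (hA : A.IsSymm) (x y : Fin n → ℝ) : x ⬝ᵥ A.mulVec y = y ⬝ᵥ A.mulVec x := by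
  rw [dotProduct_mulVec, ← mulVec_transpose, hA.eq, dotProduct_comm]

theorem eq_of_forall_dotProduct_mulVec_eq {n : ℕ} {A B : Matrix (Fin n) (Fin n) ℝ}
    (h : ∀ x y, x ⬝ᵥ A.mulVec y = x ⬝ᵥ B.mulVec y) : A = B := by
  ext i j
  simpa using h (Pi.single i 1) (Pi.single j 1)

/-- Theorem 1 (per nodal point): with `A` symmetric and `w ≠ 0`,
`A = m wᵀ + w mᵀ` iff conditions (i)–(iii) hold. -/
theorem wellbalanced_outer_iff_conditions (n : ℕ)
    (A : Matrix (Fin n) (Fin n) ℝ) (hA : A.IsSymm) (w m : Fin n → ℝ) (hw : w ≠ 0) :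
    A = vecMulVec m w + vecMulVec w m ↔
      (w ⬝ᵥ m = (w ⬝ᵥ A.mulVec w) / (2 * (w ⬝ᵥ w))) ∧
      (∀ v : Fin n → ℝ, v ⬝ᵥ w = 0 → v ⬝ᵥ m = (v ⬝ᵥ A.mulVec w) / (w ⬝ᵥ w)) ∧
      (∀ u v : Fin n → ℝ, u ⬝ᵥ w = 0 → v ⬝ᵥ w = 0 → v ⬝ᵥ A.mulVec u = 0) := by
  have hs : w ⬝ᵥ w ≠ 0 := fun h => hw (dotProduct_self_eq_zero.mp h)
  constructor
  · rintro rfl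
    simp only [dotProduct_mulVec_outer_add_outer]
    refine ⟨?_, fun v hv => ?_, fun u v hu hv => ?_⟩
    · rw [dotProduct_comm m w]
      field_simp
      ring
    · rw [hv]
      field_simp
      ring
    · rw [hv, dotProduct_comm w u, hu]
      ring
  · rintro ⟨h1, h2, h3⟩
    refine eq_of_forall_dotProduct_mulVec_eq fun x y => ?_
    rw [dotProduct_mulVec_outer_add_outer]
    obtain ⟨a, ha⟩ : ∃ a, x ⬝ᵥ w = a * (w ⬝ᵥ w) := ⟨_, (div_mul_cancel₀ _ hs).symm⟩
    obtain ⟨b, hb⟩ : ∃ b, y ⬝ᵥ w = b * (w ⬝ᵥ w) := ⟨_, (div_mul_cancel₀ _ hs).symm⟩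
    have hx : (x - a • w) ⬝ᵥ w = 0 := by simp [sub_dotProduct, ha]
    have hy : (y - b • w) ⬝ᵥ w = 0 := by simp [sub_dotProduct, hb]
    have hxm := h2 _ hx
    have hym := h2 _ hy
    have hxy := h3 _ _ hy hx
    rw [eq_div_iff hs] at hxm hym
    rw [eq_div_iff (mul_ne_zero two_ne_zero hs)] at h1
    simp only [sub_dotProduct, smul_dotProduct, mulVec_sub, mulVec_smul, dotProduct_sub,
      dotProduct_smul, smul_eq_mul] at hxm hym hxy
    rw [dotProduct_mulVec_comm_of_isSymm hA w y] at hxy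
    rw [dotProduct_comm w y, dotProduct_comm m y, ha, hb]
    linear_combination hxy - b * hxm - a * hym - a * b * h1
end

section
/- (Existence of a compatible averaging rule.) Let A be a symmetric n×n real matrix and let w ∈ ℝⁿ with w ≠ 0. If ⟨v, A u⟩ = 0 for all u, v ∈ ℝⁿ satisfying ⟨u, w⟩ = 0 and ⟨v, w⟩ = 0, then there exists m ∈ ℝⁿ such that A = m wᵀ + w mᵀ. -/
open Matrix

/-- Existence of a compatible averaging rule: if `A` is symmetric, `w ≠ 0`, and
`⟨v, A u⟩ = 0` for all `u, v ⟂ w`, then some `m` satisfies `A = m wᵀ + w mᵀ`. -/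
theorem exists_compatible_averaging (n : ℕ)
    (A : Matrix (Fin n) (Fin n) ℝ) (hA : A.IsSymm) (w : Fin n → ℝ) (hw : w ≠ 0)
    (h : ∀ u v : Fin n → ℝ, u ⬝ᵥ w = 0 → v ⬝ᵥ w = 0 → v ⬝ᵥ A.mulVec u = 0) :
    ∃ m : Fin n → ℝ, A = vecMulVec m w + vecMulVec w m := by
  obtain ⟨p, hp : w p ≠ 0⟩ := Function.ne_iff.mp hw
  refine ⟨fun i => A i p / w p - w i * A p p / (2 * w p ^ 2), ?_⟩
  ext i j
  have orth (k : Fin n) : (Pi.single k (w p) - Pi.single p (w k) : Fin n → ℝ) ⬝ᵥ w = 0 := by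
    simp only [sub_dotProduct, single_dotProduct]
    ring
  have key := h _ _ (orth j) (orth i)
  simp only [mulVec_sub, dotProduct_sub, sub_dotProduct, single_dotProduct, mulVec_single,
    Pi.smul_apply, col_apply, op_smul_eq_mul] at key
  have hsymm : A p j = A j p := hA.apply j p
  rw [hsymm] at key
  simp only [Matrix.add_apply, vecMulVec_apply]
  field_simp
  linear_combination 2 * key
end

section
/- (Exact preservation of the lake at rest.) Let m, w ∈ ℝⁿ, let A = m wᵀ + w mᵀ, and suppose ⟨w, 𝟙⟩ = 0, where 𝟙 is the all-ones vector. Then for every c ∈ ℝ and every h, b ∈ ℝⁿ with h_j + b_j = c for all j (the discrete lake-at-rest configuration), one has ½⟨h, A h⟩ = −⟨m, h⟩ · ⟨w, b⟩; that is, the discrete flux term ½ D_x^f h² exactly balances the discrete source term −h̄ · D_x^s b at the nodal point. -/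
open Matrix

/-- The quadratic form of the symmetrized outer product `m wᵀ + w mᵀ`. -/
theorem dotProduct_vecMulVec_add_mulVec {ι R : Type*} [Fintype ι] [CommRing R] (m w h : ι → R) :
    h ⬝ᵥ (vecMulVec m w + vecMulVec w m).mulVec h = 2 * ((m ⬝ᵥ h) * (w ⬝ᵥ h)) := by
  simp only [add_mulVec, vecMulVec_mulVec, op_smul_eq_smul, dotProduct_comm h, add_dotProduct,
    smul_dotProduct, smul_eq_mul]
  ring

/-- Exact preservation of the lake at rest: with `A = m wᵀ + w mᵀ` and
`⟨w, 𝟙⟩ = 0`, for every lake-at-rest configuration `h + b = c` one has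
`½⟨h, A h⟩ = −⟨m, h⟩ ⟨w, b⟩`. -/
theorem lake_at_rest_balance (n : ℕ) (m w : Fin n → ℝ)
    (A : Matrix (Fin n) (Fin n) ℝ)
    (hAdef : A = vecMulVec m w + vecMulVec w m)
    (hw1 : w ⬝ᵥ (fun _ => (1 : ℝ)) = 0) :
    ∀ (c : ℝ) (h b : Fin n → ℝ), (∀ j, h j + b j = c) →
      (1 / 2) * (h ⬝ᵥ A.mulVec h) = -((m ⬝ᵥ h) * (w ⬝ᵥ b)) := by
  intro c h b hhb
  have hb : b = c • (fun _ => (1 : ℝ)) - h := by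
    ext j
    simp [← hhb j]
  have hwb : w ⬝ᵥ b = -(w ⬝ᵥ h) := by
    rw [hb, dotProduct_sub, dotProduct_smul, hw1, smul_zero, zero_sub]
  rw [hwb, hAdef, dotProduct_vecMulVec_add_mulVec]
  ring
end

section
/- (Theorem 2: consistency of W^f inherited from M and W^s.) Let x₁,…,xₙ ∈ ℝ be nodes, fix an index i, and let m, w ∈ ℝⁿ and P, Q ∈ ℕ. Assume condition A_P holds (⟨m, x^(p)⟩ = (x_i)^p for all 0 ≤ p ≤ P) and condition B_Q holds (⟨w, x^(p)⟩ = p (x_i)^{p−1} for all 0 ≤ p ≤ Q, interpreted as 0 when p = 0). Let A = m wᵀ + w mᵀ. Then condition C_{R,R} holds with R = min(P, Q): for all 0 ≤ p, q ≤ min(P, Q), ⟨x^(q), A x^(p)⟩ = (p+q)(x_i)^{p+q−1} (interpreted as 0 when p + q = 0). -/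
open Matrix

theorem dotProduct_vecMulVec_mulVec {ι R : Type*} [Fintype ι] [CommSemiring R]
    (u a b v : ι → R) : u ⬝ᵥ (vecMulVec a b *ᵥ v) = (a ⬝ᵥ u) * (b ⬝ᵥ v) := by
  rw [vecMulVec_mulVec, op_smul_eq_smul, dotProduct_smul, smul_eq_mul, mul_comm,
    dotProduct_comm u a]

theorem pow_mul_natCast_mul_pow_pred_add {R : Type*} [CommSemiring R] (t : R) (p q : ℕ) :
    t ^ q * (p * t ^ (p - 1)) + q * t ^ (q - 1) * t ^ p = ((p + q : ℕ) : R) * t ^ (p + q - 1) := by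
  rcases p with _ | p <;> rcases q with _ | q
  · simp
  · simp
  · simp
  · rw [show p + 1 + (q + 1) - 1 = p + q + 1 by omega]
    simp only [Nat.add_sub_cancel]
    push_cast
    ring

/-- Theorem 2: consistency of `W^f` inherited from `M` and `W^s`.
If condition `A_P` holds for the averaging stencil `m` and condition `B_Q` holds
for the source stencil `w`, and `A = m wᵀ + w mᵀ`, then condition `C_{R,R}`
holds with `R = min P Q`. -/
theorem consistency_flux_from_avg_source (n : ℕ) (x : Fin n → ℝ) (i : Fin n)
    (m w : Fin n → ℝ) (P Q : ℕ)
    (A : Matrix (Fin n) (Fin n) ℝ)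
    (hAdef : A = vecMulVec m w + vecMulVec w m)
    (hAP : ∀ p : ℕ, p ≤ P → (m ⬝ᵥ fun j => (x j) ^ p) = (x i) ^ p)
    (hBQ : ∀ p : ℕ, p ≤ Q → (w ⬝ᵥ fun j => (x j) ^ p) = (p : ℝ) * (x i) ^ (p - 1)) :
    ∀ p q : ℕ, p ≤ min P Q → q ≤ min P Q →
      ((fun j => (x j) ^ q) ⬝ᵥ A.mulVec (fun j => (x j) ^ p)) =
        ((p + q : ℕ) : ℝ) * (x i) ^ (p + q - 1) := by
  intro p q hp hq
  obtain ⟨hpP, hpQ⟩ := le_min_iff.mp hp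
  obtain ⟨hqP, hqQ⟩ := le_min_iff.mp hq
  rw [hAdef, add_mulVec, dotProduct_add, dotProduct_vecMulVec_mulVec,
    dotProduct_vecMulVec_mulVec, hAP q hqP, hBQ p hpQ, hBQ q hqQ, hAP p hpP,
    pow_mul_natCast_mul_pow_pred_add]
end

section
/- (Theorem 3: accuracy of W^s inherited from M and W^f.) Let x₁,…,xₙ ∈ ℝ be nodes, fix an index i, let m, w ∈ ℝⁿ, P, Q ∈ ℕ, and let A = m wᵀ + w mᵀ. Assume condition A_0 holds (⟨m, x^(0)⟩ = 1) and condition C_{P,Q} holds (⟨x^(q), A x^(p)⟩ = (p+q)(x_i)^{p+q−1} for all 0 ≤ p ≤ P, 0 ≤ q ≤ Q, interpreted as 0 when p + q = 0). Then condition B_S holds with S = max(P, Q): ⟨w, x^(p)⟩ = p (x_i)^{p−1} for all 0 ≤ p ≤ max(P, Q) (interpreted as 0 when p = 0). -/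
open Matrix

theorem dotProduct_mulVec_symm_vecMulVec {ι R : Type*} [Fintype ι] [CommRing R]
    (m w u v : ι → R) :
    u ⬝ᵥ (vecMulVec m w + vecMulVec w m).mulVec v =
      (m ⬝ᵥ u) * (w ⬝ᵥ v) + (w ⬝ᵥ u) * (m ⬝ᵥ v) := by
  simp only [add_mulVec, vecMulVec_mulVec, dotProduct_comm u, add_dotProduct,
    smul_dotProduct, op_smul_eq_smul, smul_eq_mul]
  ring

/-- Theorem 3: accuracy of `W^s` inherited from `M` and `W^f`.
If `A = m wᵀ + w mᵀ`, condition `A_0` holds for `m`, and condition `C_{P,Q}`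
holds for `A`, then condition `B_S` holds for `w` with `S = max P Q`. -/
theorem accuracy_source_from_avg_flux (n : ℕ) (x : Fin n → ℝ) (i : Fin n)
    (m w : Fin n → ℝ) (P Q : ℕ)
    (A : Matrix (Fin n) (Fin n) ℝ)
    (hAdef : A = vecMulVec m w + vecMulVec w m)
    (hA0 : (m ⬝ᵥ fun j => (x j) ^ (0 : ℕ)) = 1)
    (hC : ∀ p q : ℕ, p ≤ P → q ≤ Q →
      ((fun j => (x j) ^ q) ⬝ᵥ A.mulVec (fun j => (x j) ^ p)) =
        ((p + q : ℕ) : ℝ) * (x i) ^ (p + q - 1)) :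
    ∀ p : ℕ, p ≤ max P Q → (w ⬝ᵥ fun j => (x j) ^ p) = (p : ℝ) * (x i) ^ (p - 1) := by
  subst hAdef
  simp only [dotProduct_mulVec_symm_vecMulVec] at hC
  have hw : (w ⬝ᵥ fun j => (x j) ^ (0 : ℕ)) = 0 := by
    have h := hC 0 0 (Nat.zero_le P) (Nat.zero_le Q)
    rw [hA0] at h
    norm_num at h ⊢
    linarith
  intro p hp
  rcases le_max_iff.mp hp with hp | hp
  · simpa only [hA0, hw, one_mul, zero_mul, add_zero] using hC p 0 hp (Nat.zero_le Q)
  · simpa only [hA0, hw, mul_one, mul_zero, zero_add] using hC 0 p (Nat.zero_le P) hp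
end

section
/- (Theorem 5: no well-balanced scheme with a higher-order diagonal flux slice.) Let D be an n×n real diagonal matrix having more than two nonzero diagonal entries (i.e., the set {j : D_{jj} ≠ 0} has at least three elements). Then there exist no vectors m, w ∈ ℝⁿ with D = m wᵀ + w mᵀ; consequently no well-balanced scheme exists whose flux-derivative slice at some node equals D. -/
open Matrix

/-- Theorem 5: if `D` is a diagonal matrix with more than two nonzero diagonal
entries, then no vectors `m, w` satisfy `D = m wᵀ + w mᵀ`; hence no
well-balanced scheme exists whose flux-derivative slice equals `D`. -/
theorem no_wellbalanced_diagonal_flux (n : ℕ) (D : Matrix (Fin n) (Fin n) ℝ)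
    (hdiag : D.IsDiag)
    (hcard : 3 ≤ (Finset.univ.filter fun j : Fin n => D j j ≠ 0).card) :
    ¬ ∃ m w : Fin n → ℝ, D = vecMulVec m w + vecMulVec w m := by
  rintro ⟨m, w, rfl⟩
  obtain ⟨a, b, c, ha, hb, hc, hab, hac, hbc⟩ := Finset.two_lt_card_iff.mp hcard
  have h₁ := hdiag hab
  have h₂ := hdiag hbc
  have h₃ := hdiag hac
  replace ha := (Finset.mem_filter.mp ha).2
  replace hb := (Finset.mem_filter.mp hb).2
  replace hc := (Finset.mem_filter.mp hc).2
  simp only [Matrix.add_apply, vecMulVec_apply] at ha hb hc h₁ h₂ h₃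
  have ne_zero {x y : ℝ} (h : x * y + y * x ≠ 0) : x * y ≠ 0 := by
    intro hxy
    exact h (by rw [mul_comm y x, hxy, add_zero])
  have hprod : (m a * w a) * (m b * w b) * (m c * w c) = 0 := by
    linear_combination (m b * w c * (m c * w a)) / 2 * h₁ -
      (w a * m b * (m c * w a)) / 2 * h₂ + (w a * m b * (w b * m c)) / 2 * h₃
  exact mul_ne_zero (mul_ne_zero (ne_zero ha) (ne_zero hb)) (ne_zero hc) hprod
end

section
/- (Example 3: characterization of well-balanced three-point flux slices for the centered source stencil.) Let n ≥ 3, let a, i, b be three distinct indices of ℝⁿ (playing the roles of i−1, i, i+1), let Δx ≠ 0, and set w = (1/(2Δx))(e_b − e_a). Let A be a symmetric n×n real matrix whose entries A_{jk} vanish unless both j and k lie in {a, i, b}. Then there exists m ∈ ℝⁿ with A = m wᵀ + w mᵀ if and only if A_{ii} = 0, A_{ai} + A_{ib} = 0, and A_{aa} + 2A_{ab} + A_{bb} = 0. -/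
open Matrix

/-- Example 3: characterization of well-balanced three-point symmetric flux
slices compatible with the centered source stencil
`w = (1/(2Δx))(e_b − e_a)`. -/
theorem centered_source_three_point_characterization (n : ℕ) (hn : 3 ≤ n)
    (a i b : Fin n) (hai : a ≠ i) (hab : a ≠ b) (hib : i ≠ b)
    (Δx : ℝ) (hΔx : Δx ≠ 0)
    (A : Matrix (Fin n) (Fin n) ℝ) (hA : A.IsSymm)
    (hsupp : ∀ j k : Fin n, A j k ≠ 0 → j ∈ ({a, i, b} : Set (Fin n)) ∧
      k ∈ ({a, i, b} : Set (Fin n))) :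
    (∃ m : Fin n → ℝ,
        A = vecMulVec m ((1 / (2 * Δx)) • (Pi.single b 1 - Pi.single a 1)) +
            vecMulVec ((1 / (2 * Δx)) • (Pi.single b 1 - Pi.single a 1)) m) ↔
      (A i i = 0 ∧ A a i + A i b = 0 ∧ A a a + 2 * A a b + A b b = 0) := by
  have hab' : b ≠ a := hab.symm
  have hia : i ≠ a := hai.symm
  constructor
  · rintro ⟨m, rfl⟩
    simp only [Matrix.add_apply, vecMulVec_apply, Pi.smul_apply, Pi.sub_apply, smul_eq_mul,
      Pi.single_apply, hab, hab', hia, hib, if_true, if_false]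
    refine ⟨?_, ?_, ?_⟩ <;> ring
  · rintro ⟨hii, hodd, heven⟩
    have zero_row : ∀ j k, j ≠ a → j ≠ i → j ≠ b → A j k = 0 := by
      intro j k ha hi hb
      by_contra h
      simpa [ha, hi, hb] using (hsupp j k h).1
    have zero_col : ∀ j k, k ≠ a → k ≠ i → k ≠ b → A j k = 0 := fun j k ha hi hb =>
      (hA.apply k j).trans (zero_row k j ha hi hb)
    have hba : A b a = A a b := hA.apply a b
    have hAia : A i a = A a i := hA.apply a i
    have hAbi : A b i = A i b := hA.apply i b
    have row_cases : ∀ j, j = a ∨ j = i ∨ j = b ∨ (j ≠ a ∧ j ≠ i ∧ j ≠ b) := by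
      intro j; tauto
    refine ⟨fun j => if j = a then -Δx * A a a else if j = b then Δx * A b b
      else 2 * Δx * A j b, ?_⟩
    ext j k
    simp only [Matrix.add_apply, vecMulVec_apply, Pi.smul_apply, Pi.sub_apply, smul_eq_mul,
      Pi.single_apply]
    rcases row_cases j with hj | hj | hj | ⟨ja, ji, jb⟩
    on_goal 4 => simp [zero_row j _ ja ji jb, ja, jb]
    all_goals
      rcases row_cases k with hk | hk | hk | ⟨ka, ki, kb⟩
      on_goal 4 => simp [zero_col _ k ka ki kb, zero_row k _ ka ki kb, ka, kb]
      all_goals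
        simp only [hj, hk, hab, hab', hia, hib, hba, hAia, hAbi, hii, if_true, if_false]
        field_simp
        linarith
end

section
/- (Example 3, flux-form conclusion: centered source forces centered flux.) Let n ≥ 3, let a, i, b be three distinct indices of ℝⁿ (playing the roles of i−1, i, i+1), let Δx ≠ 0, and set w = (1/(2Δx))(e_b − e_a). Let A be a diagonal n×n real matrix whose diagonal entries vanish outside {a, i, b}. Then there exists m ∈ ℝⁿ with A = m wᵀ + w mᵀ if and only if A_{ii} = 0 and A_{aa} = −A_{bb}; i.e., the only consistent well-balanced flux-form (diagonal) slices compatible with the centered source stencil are scalar multiples of e_b e_bᵀ − e_a e_aᵀ, the centered-difference flux slice. -/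
open Matrix

/-- Example 3 (flux-form conclusion): for the centered source stencil
`w = (1/(2Δx))(e_b − e_a)` and a diagonal flux slice `A` supported on
`{a, i, b}`, a compatible averaging stencil exists iff `A_{ii} = 0` and
`A_{aa} = −A_{bb}`. -/
theorem centered_source_diagonal_flux (n : ℕ) (hn : 3 ≤ n)
    (a i b : Fin n) (hai : a ≠ i) (hab : a ≠ b) (hib : i ≠ b)
    (Δx : ℝ) (hΔx : Δx ≠ 0)
    (A : Matrix (Fin n) (Fin n) ℝ) (hdiag : A.IsDiag)
    (hsupp : ∀ j : Fin n, j ∉ ({a, i, b} : Set (Fin n)) → A j j = 0) :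
    (∃ m : Fin n → ℝ,
        A = vecMulVec m ((1 / (2 * Δx)) • (Pi.single b 1 - Pi.single a 1)) +
            vecMulVec ((1 / (2 * Δx)) • (Pi.single b 1 - Pi.single a 1)) m) ↔
      (A i i = 0 ∧ A a a = -A b b) := by
  constructor
  · rintro ⟨m, hm⟩
    have entry (j k : Fin n) := congrFun (congrFun hm j) k
    have haa := entry a a
    have hbb := entry b b
    have hii := entry i i
    have h_ab := entry a b
    simp only [Matrix.add_apply, vecMulVec_apply, Pi.smul_apply, Pi.sub_apply, Pi.single_apply,
      hab, hab.symm, hib, hai.symm, if_true, if_false, smul_eq_mul] at haa hbb hii h_ab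
    rw [hdiag hab] at h_ab
    exact ⟨by linarith, by linarith⟩
  · rintro ⟨hii, haa⟩
    refine ⟨(Δx * A b b) • (Pi.single a 1 + Pi.single b 1), ?_⟩
    ext j k
    simp only [Matrix.add_apply, vecMulVec_apply, Pi.smul_apply, Pi.sub_apply, Pi.add_apply,
      Pi.single_apply, smul_eq_mul]
    by_cases hjk : j = k
    · subst hjk
      by_cases hja : j = a
      · subst hja
        simp only [haa, hab, if_true, if_false]
        field_simp
        ring
      by_cases hjb : j = b
      · subst hjb
        simp only [hab.symm, if_true, if_false]
        field_simp
        ring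
      have hj : A j j = 0 := by
        by_cases hji : j = i
        · rw [hji, hii]
        · exact hsupp j (by simp [hja, hjb, hji])
      simp [hj, hja, hjb]
    · rw [hdiag hjk]
      split_ifs <;> first | ring1 | grind
end

section
/- (Example 4: centered source with second-order upwind flux is never well-balanced.) Let n ≥ 4, let a, b, i, c be four distinct indices of ℝⁿ (playing the roles of i−2, i−1, i, i+1), let Δx ≠ 0, set w = (1/(2Δx))(e_c − e_b) (the centered source stencil) and A = (1/(2Δx))(3 e_i e_iᵀ − 4 e_b e_bᵀ + e_a e_aᵀ) (the second-order upwind flux slice). Then there exists no m ∈ ℝⁿ with A = m wᵀ + w mᵀ. -/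
open Matrix

/-- Example 4: centered source stencil with second-order upwind flux slice is
never well-balanced: no averaging stencil `m` satisfies `A = m wᵀ + w mᵀ`. -/
theorem centered_source_second_order_upwind_flux_not_wellbalanced
    (n : ℕ) (hn : 4 ≤ n) (a b i c : Fin n)
    (hab : a ≠ b) (hai : a ≠ i) (hac : a ≠ c) (hbi : b ≠ i) (hbc : b ≠ c)
    (hic : i ≠ c) (Δx : ℝ) (hΔx : Δx ≠ 0) :
    let e : Fin n → (Fin n → ℝ) := fun l => Pi.single l 1
    let w : Fin n → ℝ := (1 / (2 * Δx)) • (e c - e b)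
    let A : Matrix (Fin n) (Fin n) ℝ :=
      (1 / (2 * Δx)) • ((3 : ℝ) • vecMulVec (e i) (e i) -
        (4 : ℝ) • vecMulVec (e b) (e b) + vecMulVec (e a) (e a))
    ¬ ∃ m : Fin n → ℝ, A = vecMulVec m w + vecMulVec w m := by
  rintro e w A ⟨m, hm⟩
  have hii := congrFun (congrFun hm i) i
  simp [A, w, e, vecMulVec_apply, hic, hai.symm, hbi.symm, hΔx] at hii
end

section
/- (Example 5: second-order upwinding for both derivatives is never well-balanced.) Let n ≥ 3, let a, b, i be three distinct indices of ℝⁿ (playing the roles of i−2, i−1, i), let Δx ≠ 0, set w = (1/(2Δx))(3 e_i − 4 e_b + e_a) and A = (1/(2Δx))(3 e_i e_iᵀ − 4 e_b e_bᵀ + e_a e_aᵀ). Then there exists no m ∈ ℝⁿ with A = m wᵀ + w mᵀ. -/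
open Matrix

/-- Example 5: second-order upwinding for both the source and flux derivatives
is never well-balanced: no averaging stencil `m` satisfies `A = m wᵀ + w mᵀ`. -/
theorem second_order_upwind_both_not_wellbalanced
    (n : ℕ) (hn : 3 ≤ n) (a b i : Fin n)
    (hab : a ≠ b) (hai : a ≠ i) (hbi : b ≠ i) (Δx : ℝ) (hΔx : Δx ≠ 0) :
    let e : Fin n → (Fin n → ℝ) := fun l => Pi.single l 1
    let w : Fin n → ℝ := (1 / (2 * Δx)) • ((3 : ℝ) • e i - (4 : ℝ) • e b + e a)
    let A : Matrix (Fin n) (Fin n) ℝ :=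
      (1 / (2 * Δx)) • ((3 : ℝ) • vecMulVec (e i) (e i) -
        (4 : ℝ) • vecMulVec (e b) (e b) + vecMulVec (e a) (e a))
    ¬ ∃ m : Fin n → ℝ, A = vecMulVec m w + vecMulVec w m := by
  rintro e w A ⟨m, hA⟩
  have hc : 1 / (2 * Δx) ≠ 0 := by positivity
  have hii := congrFun₂ hA i i
  have hbb := congrFun₂ hA b b
  have hib := congrFun₂ hA i b
  simp only [A, w, e] at hii hbb hib
  generalize 1 / (2 * Δx) = c at hc hii hbb hib
  simp [vecMulVec_apply, hab.symm, hai.symm, hbi, hbi.symm] at hii hbb hib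
  have hmi : m i = 1 / 2 := mul_left_cancel₀ hc (by linarith)
  have hmb : m b = 1 / 2 := mul_left_cancel₀ hc (by linarith)
  rw [hmi, hmb] at hib
  exact hc (by linarith)
end
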